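/- Let m ≥ 3 and let G be an m-free digraph obtained from a tournament on n vertices by deleting t edges. Then one can delete an additional ⌈t/(m-2)⌉ (at most t/(m-2)) edges from G so that the resulting digraph is acyclic. -/

import Mathlib

/-- Out-degree of `v`: the number of out-neighbors. -/
noncomputable def outDeg {V : Type*} (Adj : V → V → Prop) (v : V) : ℕ :=
  {w | Adj v w}.ncard

/-- The set of vertices at directed distance exactly 2 from `v`. -/
def secondNbr {V : Type*} (Adj : V → V → Prop) (v : V) : Set V :=
  {w | w ≠ v ∧ ¬ Adj v w ∧ ∃ u, Adj v u ∧ Adj u w}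

/-- `Adj` has a directed cycle of length `k`. -/
def HasCycleOfLength {V : Type*} (Adj : V → V → Prop) (k : ℕ) : Prop :=
  ∃ c : Fin k → V, Function.Injective c ∧ ∀ i : Fin k, Adj (c i) (c ⟨(i.val + 1) % k, Nat.mod_lt _ i.pos⟩)

/-- `Adj` has no directed cycles. -/
def Acyclic {V : Type*} (Adj : V → V → Prop) : Prop :=
  ∀ k : ℕ, 1 ≤ k → ¬ HasCycleOfLength Adj k

/-- `Adj` is `m`-free: it has no directed cycle of length at most `m`. -/
def MFree {V : Type*} (Adj : V → V → Prop) (m : ℕ) : Prop :=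
  ∀ k : ℕ, 1 ≤ k → k ≤ m → ¬ HasCycleOfLength Adj k

/-- `T` is a tournament: irreflexive and exactly one arc between distinct vertices. -/
def IsTournament {V : Type*} (T : V → V → Prop) : Prop :=
  (∀ v, ¬ T v v) ∧ ∀ a b : V, a ≠ b → (T a b ↔ ¬ T b a)

/-- The number of arcs of `T` that are missing in `Adj`. -/
noncomputable def deletedCount {V : Type*} (T Adj : V → V → Prop) : ℕ :=
  {p : V × V | T p.1 p.2 ∧ ¬ Adj p.1 p.2}.ncard

open Finset

/-- There is a directed walk of length `k` from `x` to `y`. -/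
def HasWalk {V : Type*} (Adj : V → V → Prop) : ℕ → V → V → Prop
  | 0, x, y => x = y
  | k + 1, x, y => ∃ z, Adj x z ∧ HasWalk Adj k z y

/-- The directed distance from `x` to `y` is `k`. -/
def IsDist {V : Type*} (Adj : V → V → Prop) (k : ℕ) (x y : V) : Prop :=
  HasWalk Adj k x y ∧ ∀ j < k, ¬ HasWalk Adj j x y

section Walk

variable {V : Type*} {Adj : V → V → Prop}

lemma HasWalk.trans {k l : ℕ} {x y z : V} (h : HasWalk Adj k x y) (h' : HasWalk Adj l y z) :
    HasWalk Adj (k + l) x z := by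
  induction k generalizing x with
  | zero =>
    obtain rfl : x = y := h
    simpa using h'
  | succ k ih =>
    obtain ⟨u, hu, hw⟩ := h
    rw [Nat.succ_add]
    exact ⟨u, hu, ih hw⟩

lemma HasWalk.of_adj {x y : V} (h : Adj x y) : HasWalk Adj 1 x y := ⟨y, h, rfl⟩

lemma HasWalk.mono {Adj' : V → V → Prop} (hle : ∀ a b, Adj a b → Adj' a b) {k : ℕ} {x y : V}
    (h : HasWalk Adj k x y) : HasWalk Adj' k x y := by
  induction k generalizing x with
  | zero => exact h
  | succ k ih =>
    obtain ⟨u, hu, hw⟩ := h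
    exact ⟨u, hle _ _ hu, ih hw⟩

lemma HasWalk.reverse {k : ℕ} {x y : V} (h : HasWalk Adj k x y) :
    HasWalk (fun a b => Adj b a) k y x := by
  induction k generalizing x with
  | zero => exact Eq.symm h
  | succ k ih =>
    obtain ⟨u, hu, hw⟩ := h
    exact (ih hw).trans (HasWalk.of_adj (Adj := fun a b => Adj b a) hu)

lemma hasWalk_reverse {k : ℕ} {x y : V} :
    HasWalk (fun a b => Adj b a) k x y ↔ HasWalk Adj k y x :=
  ⟨fun h => h.reverse, fun h => h.reverse⟩

lemma isDist_reverse {k : ℕ} {x y : V} :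
    IsDist (fun a b => Adj b a) k x y ↔ IsDist Adj k y x := by
  simp only [IsDist, hasWalk_reverse]

lemma IsDist.unique {k l : ℕ} {x y : V} (h : IsDist Adj k x y) (h' : IsDist Adj l x y) :
    k = l := by
  rcases lt_trichotomy k l with hlt | heq | hlt
  · exact absurd h.1 (h'.2 k hlt)
  · exact heq
  · exact absurd h'.1 (h.2 l hlt)

lemma HasWalk.exists_seq {k : ℕ} {x y : V} (h : HasWalk Adj k x y) :
    ∃ c : ℕ → V, c 0 = x ∧ c k = y ∧ ∀ i < k, Adj (c i) (c (i + 1)) := by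
  induction k generalizing x with
  | zero => exact ⟨fun _ => x, rfl, h, by simp⟩
  | succ k ih =>
    obtain ⟨u, hu, hw⟩ := h
    obtain ⟨c, h0, hk, hc⟩ := ih hw
    refine ⟨fun i => Nat.casesOn i x c, rfl, hk, fun i hi => ?_⟩
    cases i with
    | zero => simpa [h0] using hu
    | succ i => exact hc i (by omega)

lemma HasWalk.of_seq {c : ℕ → V} {i l : ℕ} (hc : ∀ j, i ≤ j → j < i + l → Adj (c j) (c (j + 1))) :
    HasWalk Adj l (c i) (c (i + l)) := by
  induction l with
  | zero => exact rfl
  | succ l ih =>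
    exact (ih fun j h1 h2 => hc j h1 (by omega)).trans
      (HasWalk.of_adj (hc (i + l) (by omega) (by omega)))

lemma MFree.not_hasWalk {m : ℕ} (hfree : MFree Adj m) (k : ℕ) (hk : 1 ≤ k) (hkm : k ≤ m)
    (x : V) : ¬ HasWalk Adj k x x := by
  induction k using Nat.strong_induction_on generalizing x with
  | _ k ih =>
    intro h
    obtain ⟨c, h0, hck, hc⟩ := h.exists_seq
    have hinj : ∀ i j, i < j → j < k → c i ≠ c j := by
      intro i j hij hjk heq
      have hw : HasWalk Adj (j - i) (c i) (c (i + (j - i))) :=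
        HasWalk.of_seq fun l _ h2 => hc l (by omega)
      rw [show i + (j - i) = j by omega, ← heq] at hw
      exact ih (j - i) (by omega) (by omega) (by omega) _ hw
    refine hfree k hk hkm ⟨fun i => c i, fun i j hij => ?_, fun i => ?_⟩
    · by_contra hne
      rcases lt_or_gt_of_ne (fun h => hne (Fin.ext h) : (i : ℕ) ≠ j) with hlt | hlt
      · exact hinj _ _ hlt j.2 hij
      · exact hinj _ _ hlt i.2 hij.symm
    · have hi := hc i i.2
      rcases Nat.lt_or_ge (i + 1) k with hlt | hge
      · simpa [Nat.mod_eq_of_lt hlt] using hi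
      · have : (i : ℕ) + 1 = k := by have := i.2; omega
        simpa [this, h0, hck] using hi

lemma HasWalk.mem_of_pos {Adj : V → V → Prop} {S : Finset V}
    (hS : ∀ a b, Adj a b → a ∈ S ∧ b ∈ S) {k : ℕ} (hk : 1 ≤ k) {x y : V}
    (h : HasWalk Adj k x y) : y ∈ S := by
  induction k generalizing x with
  | zero => omega
  | succ k ih =>
    obtain ⟨u, hu, hw⟩ := h
    rcases Nat.eq_zero_or_pos k with rfl | hk
    · obtain rfl : u = y := hw
      exact (hS _ _ hu).2
    · exact ih hk hw

end Walk

section Cut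

open Classical

variable {V : Type*}

/-- The arcs leaving `X` inside `S`. -/
noncomputable def leavingArcs (Adj : V → V → Prop) (S X : Finset V) : Finset (V × V) :=
  {p ∈ X ×ˢ (S \ X) | Adj p.1 p.2}

/-- The nonadjacent pairs between `X` and `S \ X`. -/
noncomputable def crossNonadj (Adj : V → V → Prop) (S X : Finset V) : Finset (V × V) :=
  {p ∈ X ×ˢ (S \ X) | ¬ Adj p.1 p.2 ∧ ¬ Adj p.2 p.1}

/-- The pairs of vertices of `S` related by `R`. -/
noncomputable def pairsIn (R : V → V → Prop) (S : Finset V) : Finset (V × V) :=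
  {p ∈ S ×ˢ S | R p.1 p.2}

lemma card_pairsIn_add_le {M Adj : V → V → Prop} {S X : Finset V} (hXS : X ⊆ S)
    (hM : ∀ a b, a ≠ b → ¬ Adj a b → ¬ Adj b a → M a b ∨ M b a) :
    #(pairsIn M X) + #(pairsIn M (S \ X)) + #(crossNonadj Adj S X) ≤ #(pairsIn M S) := by
  have hcross : #(crossNonadj Adj S X) ≤
      #({p ∈ pairsIn M S | ¬ (p.1 ∈ X ↔ p.2 ∈ X)}) := by
    refine Finset.card_le_card_of_injOn (fun p => if M p.1 p.2 then p else p.swap) ?_ ?_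
    · rintro ⟨a, w⟩ h
      simp only [crossNonadj, coe_filter, mem_product, mem_sdiff, Set.mem_ofPred_eq] at h
      obtain ⟨⟨haX, hwS, hwX⟩, h1, h2⟩ := h
      have := hM a w (fun h => hwX (h ▸ haX)) h1 h2
      have haS := hXS haX
      by_cases h : M a w <;> simp_all [pairsIn]
    · rintro ⟨a, w⟩ h ⟨a', w'⟩ h' heq
      simp only [crossNonadj, coe_filter, mem_product, mem_sdiff, Set.mem_ofPred_eq] at h h'
      dsimp only at heq
      split_ifs at heq <;> simp only [Prod.swap_prod_mk, Prod.mk.injEq] at heq <;> grind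
  have hinner : #(pairsIn M X) + #(pairsIn M (S \ X)) ≤
      #({p ∈ pairsIn M S | (p.1 ∈ X ↔ p.2 ∈ X)}) := by
    rw [← Finset.card_union_of_disjoint]
    · refine Finset.card_le_card ?_
      rintro ⟨a, b⟩ h
      simp only [pairsIn, mem_union, mem_filter, mem_product, mem_sdiff] at h ⊢
      have := @hXS a
      have := @hXS b
      tauto
    · rw [Finset.disjoint_left]
      rintro ⟨a, b⟩ h
      simp only [pairsIn, mem_filter, mem_product, mem_sdiff] at h ⊢
      tauto
  have := Finset.card_filter_add_card_filter_not (s := pairsIn M S) (fun p => (p.1 ∈ X ↔ p.2 ∈ X))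
  omega

variable [Fintype V]

/-- The vertices reached from `v` by a walk of length between `1` and `i`. -/
noncomputable def outBall (Adj : V → V → Prop) (v : V) (i : ℕ) : Finset V :=
  {x | ∃ p, 1 ≤ p ∧ p ≤ i ∧ HasWalk Adj p v x}

/-- The triples `(v, a, w)` where `a` is the penultimate vertex of a shortest walk of length
`i + 1` from `v` to `w`. -/
noncomputable def lastStep (Adj : V → V → Prop) (i : ℕ) : Finset (V × V × V) :=
  {q | IsDist Adj i q.1 q.2.1 ∧ Adj q.2.1 q.2.2 ∧ IsDist Adj (i + 1) q.1 q.2.2}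

/-- The triples `(x, y, z)` where `y` is the second vertex of a shortest walk of length
`i + 1` from `x` to `z`. -/
noncomputable def firstStep (Adj : V → V → Prop) (i : ℕ) : Finset (V × V × V) :=
  {q | Adj q.1 q.2.1 ∧ IsDist Adj i q.2.1 q.2.2 ∧ IsDist Adj (i + 1) q.1 q.2.2}

lemma mem_outBall {Adj : V → V → Prop} {v x : V} {i : ℕ} :
    x ∈ outBall Adj v i ↔ ∃ p, 1 ≤ p ∧ p ≤ i ∧ HasWalk Adj p v x := by
  simp [outBall]

lemma card_firstStep_reverse (Adj : V → V → Prop) (i : ℕ) :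
    #(firstStep (fun a b => Adj b a) i) = #(lastStep Adj i) := by
  refine Finset.card_bij' (fun q _ => (q.2.2, q.2.1, q.1)) (fun q _ => (q.2.2, q.2.1, q.1))
    ?_ ?_ ?_ ?_ <;> simp +contextual [firstStep, lastStep, isDist_reverse]

lemma sum_leavingArcs_le {Adj : V → V → Prop} {S : Finset V} {r i : ℕ}
    (hfree : ∀ k, 1 ≤ k → k ≤ r + 2 → ∀ x, ¬ HasWalk Adj k x x) (hi : i ≤ r) :
    ∑ v ∈ S, #(leavingArcs Adj S (outBall Adj v i)) ≤ #(lastStep Adj i) := by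
  rw [← Finset.card_sigma]
  refine Finset.card_le_card_of_injOn (fun q => (q.1, q.2.1, q.2.2)) ?_ ?_
  · rintro ⟨v, a, w⟩ h
    simp only [coe_sigma, Set.mem_sigma_iff, mem_coe, leavingArcs, mem_filter, mem_product,
      mem_sdiff, mem_outBall] at h
    obtain ⟨-, ⟨⟨p, hp1, hpi, hp⟩, -, hw⟩, haw⟩ := h
    have hvw : v ≠ w := by
      rintro rfl
      exact hfree (p + 1) (by omega) (by omega) v (hp.trans (HasWalk.of_adj haw))
    have key : ∀ j ≤ i, ¬ HasWalk Adj j v w := by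
      intro j hj hjw
      rcases Nat.eq_zero_or_pos j with rfl | hj0
      · exact hvw hjw
      · exact hw ⟨j, hj0, hj, hjw⟩
    have hshort : ∀ j < i, ¬ HasWalk Adj j v a := fun j hj hja =>
      key (j + 1) hj (hja.trans (HasWalk.of_adj haw))
    have hpi' : p = i := by
      by_contra hne
      exact hshort p (by omega) hp
    subst hpi'
    simp only [lastStep, coe_filter, mem_univ, true_and, Set.mem_ofPred_eq]
    exact ⟨⟨hp, hshort⟩, haw, hp.trans (HasWalk.of_adj haw),
      fun j hj => key j (by omega)⟩
  · rintro ⟨v, a, w⟩ - ⟨v', a', w'⟩ - h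
    simp only [Prod.mk.injEq] at h
    obtain ⟨rfl, rfl, rfl⟩ := h
    rfl

lemma sum_firstStep_le {Adj : V → V → Prop} {S : Finset V} {r i : ℕ}
    (hS : ∀ a b, Adj a b → a ∈ S ∧ b ∈ S)
    (hfree : ∀ k, 1 ≤ k → k ≤ r + 2 → ∀ x, ¬ HasWalk Adj k x x) (hi1 : 1 ≤ i) (hi : i ≤ r) :
    ∑ p ∈ Icc 1 r, #(firstStep Adj p) ≤ ∑ v ∈ S, #(crossNonadj Adj S (outBall Adj v i)) := by
  rw [← Finset.card_sigma, ← Finset.card_sigma]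
  refine Finset.card_le_card_of_injOn
    (fun q => if q.1 ≤ i then ⟨q.2.2.1, q.2.2.2, q.2.1⟩ else ⟨q.2.1, q.2.2.1, q.2.2.2⟩) ?_ ?_
  · rintro ⟨p, x, y, z⟩ h
    simp only [coe_sigma, Set.mem_sigma_iff, mem_coe, firstStep, mem_filter, mem_univ, true_and,
      mem_Icc] at h
    obtain ⟨⟨hp1, hpr⟩, hxy, hyz, hxz⟩ := h
    have hzS := hyz.1.mem_of_pos hS hp1
    simp only [coe_sigma, Set.mem_sigma_iff, mem_coe, crossNonadj, mem_filter, mem_product,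
      mem_sdiff, mem_outBall]
    split_ifs with hpi
    · refine ⟨(hS _ _ hxy).2, ⟨⟨p, hp1, hpi, hyz.1⟩, (hS _ _ hxy).1, ?_⟩, ?_, ?_⟩
      · rintro ⟨j, hj1, hji, hj⟩
        exact hfree (j + 1) (by omega) (by omega) _ (hj.trans (HasWalk.of_adj hxy))
      · intro hzx
        exact hfree (p + 1 + 1) (by omega) (by omega) _ (hxz.1.trans (HasWalk.of_adj hzx))
      · intro hxz'
        exact hxz.2 1 (by omega) (HasWalk.of_adj hxz')
    · refine ⟨(hS _ _ hxy).1, ⟨⟨1, le_rfl, hi1, HasWalk.of_adj hxy⟩, hzS, ?_⟩, ?_, ?_⟩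
      · rintro ⟨j, hj1, hji, hj⟩
        exact hxz.2 j (by omega) hj
      · intro hyz'
        exact hyz.2 1 (by omega) (HasWalk.of_adj hyz')
      · intro hzy
        exact hfree (p + 1) (by omega) (by omega) _ (hyz.1.trans (HasWalk.of_adj hzy))
  · rintro ⟨p, x, y, z⟩ h ⟨p', x', y', z'⟩ h' heq
    simp only [coe_sigma, Set.mem_sigma_iff, mem_coe, firstStep, mem_filter, mem_univ, true_and,
      mem_Icc] at h h'
    obtain ⟨⟨hp1, hpr⟩, hxy, hyz, hxz⟩ := h
    obtain ⟨⟨hp1', hpr'⟩, hxy', hyz', hxz'⟩ := h'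
    dsimp only at heq
    split_ifs at heq <;> simp only [Sigma.mk.injEq, heq_eq_eq, Prod.mk.injEq] at heq <;>
      obtain ⟨rfl, rfl, rfl⟩ := heq
    · obtain rfl := hyz.unique hyz'
      rfl
    · exact absurd (hxz'.1.trans (HasWalk.of_adj hxy)) (hfree (p' + 1 + 1) (by omega) (by omega) _)
    · exact absurd (hxz.1.trans (HasWalk.of_adj hxy')) (hfree (p + 1 + 1) (by omega) (by omega) _)
    · obtain rfl := hyz.unique hyz'
      rfl

lemma exists_cut_of_sum_le {Adj : V → V → Prop} {S : Finset V} {r : ℕ} (hr : 1 ≤ r)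
    (hS : ∀ a b, Adj a b → a ∈ S ∧ b ∈ S)
    (hfree : ∀ k, 1 ≤ k → k ≤ r + 2 → ∀ x, ¬ HasWalk Adj k x x)
    (harc : ∃ a b, Adj a b)
    (hle : ∑ p ∈ Icc 1 r, #(lastStep Adj p) ≤ ∑ p ∈ Icc 1 r, #(firstStep Adj p)) :
    ∃ X ⊂ S, X.Nonempty ∧ r * #(leavingArcs Adj S X) ≤ #(crossNonadj Adj S X) := by
  obtain ⟨a, b, hab⟩ := harc
  have hne : a ≠ b := by
    rintro rfl
    exact hfree 1 le_rfl (by omega) _ (HasWalk.of_adj hab)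
  by_cases hsink : ∃ v ∈ S, ∀ w, ¬ Adj v w
  · obtain ⟨v, hvS, hv⟩ := hsink
    refine ⟨{v}, ?_, by simp, ?_⟩
    · refine (Finset.ssubset_iff_subset_ne).2 ⟨by simpa using hvS, ?_⟩
      rintro rfl
      have := hS _ _ hab
      simp only [mem_singleton] at this
      exact hne (this.1.trans this.2.symm)
    · have : leavingArcs Adj S {v} = ∅ := by
        refine Finset.filter_eq_empty_iff.2 ?_
        rintro ⟨x, y⟩ hxy
        simp only [mem_product, mem_singleton] at hxy
        rw [hxy.1]
        exact hv y
      simp [this]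
  push Not at hsink
  have hsum : ∑ i ∈ Icc 1 r, ∑ v ∈ S, r * #(leavingArcs Adj S (outBall Adj v i)) ≤
      ∑ i ∈ Icc 1 r, ∑ v ∈ S, #(crossNonadj Adj S (outBall Adj v i)) := by
    calc ∑ i ∈ Icc 1 r, ∑ v ∈ S, r * #(leavingArcs Adj S (outBall Adj v i))
        = r * ∑ i ∈ Icc 1 r, ∑ v ∈ S, #(leavingArcs Adj S (outBall Adj v i)) := by
          simp only [Finset.mul_sum]
      _ ≤ r * ∑ p ∈ Icc 1 r, #(firstStep Adj p) := by
          refine Nat.mul_le_mul_left _ (le_trans (Finset.sum_le_sum fun i hi => ?_) hle)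
          exact sum_leavingArcs_le hfree (mem_Icc.1 hi).2
      _ = ∑ i ∈ Icc 1 r, ∑ p ∈ Icc 1 r, #(firstStep Adj p) := by simp
      _ ≤ _ := Finset.sum_le_sum fun i hi =>
          sum_firstStep_le hS hfree (mem_Icc.1 hi).1 (mem_Icc.1 hi).2
  obtain ⟨i, hi, hsum⟩ := Finset.exists_le_of_sum_le ⟨1, by simp [hr]⟩ hsum
  obtain ⟨v, hv, hcut⟩ := Finset.exists_le_of_sum_le ⟨a, (hS _ _ hab).1⟩ hsum
  rw [mem_Icc] at hi
  obtain ⟨w, hw⟩ := hsink v hv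
  refine ⟨outBall Adj v i, (Finset.ssubset_iff_of_subset ?_).2 ⟨v, hv, ?_⟩,
    ⟨w, mem_outBall.2 ⟨1, le_rfl, hi.1, HasWalk.of_adj hw⟩⟩, hcut⟩
  · intro x hx
    obtain ⟨p, hp1, -, hp⟩ := mem_outBall.1 hx
    exact hp.mem_of_pos hS hp1
  · rw [mem_outBall]
    rintro ⟨p, hp1, hpi, hp⟩
    exact hfree p hp1 (by omega) _ hp

lemma exists_cut {Adj : V → V → Prop} {S : Finset V} {r : ℕ} (hr : 1 ≤ r)
    (hS : ∀ a b, Adj a b → a ∈ S ∧ b ∈ S)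
    (hfree : ∀ k, 1 ≤ k → k ≤ r + 2 → ∀ x, ¬ HasWalk Adj k x x)
    (harc : ∃ a b, Adj a b) :
    ∃ X ⊂ S, X.Nonempty ∧ r * #(leavingArcs Adj S X) ≤ #(crossNonadj Adj S X) := by
  rcases le_total (∑ p ∈ Icc 1 r, #(lastStep Adj p)) (∑ p ∈ Icc 1 r, #(firstStep Adj p))
    with hle | hle
  · exact exists_cut_of_sum_le hr hS hfree harc hle
  · obtain ⟨X, hXS, hX, hcut⟩ := exists_cut_of_sum_le (Adj := fun a b => Adj b a) (S := S) hr
      (fun a b h => (hS b a h).symm) (fun k h1 h2 x h => hfree k h1 h2 x h.reverse)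
      (let ⟨a, b, h⟩ := harc; ⟨b, a, h⟩)
      (by
        have h1 : ∀ p, #(lastStep (fun a b => Adj b a) p) = #(firstStep Adj p) := fun p =>
          (card_firstStep_reverse (fun a b => Adj b a) p).symm
        simpa only [card_firstStep_reverse, h1] using hle)
    refine ⟨S \ X, Finset.sdiff_ssubset hXS.subset hX,
      Finset.sdiff_nonempty.2 hXS.not_subset, ?_⟩
    have hXX : S \ (S \ X) = X := Finset.sdiff_sdiff_eq_self hXS.subset
    have h1 : #(leavingArcs Adj S (S \ X)) = #(leavingArcs (fun a b => Adj b a) S X) := by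
      refine Finset.card_bij' (fun q _ => q.swap) (fun q _ => q.swap) ?_ ?_ ?_ ?_ <;>
        simp +contextual [leavingArcs, hXX]
    have h2 : #(crossNonadj Adj S (S \ X)) = #(crossNonadj (fun a b => Adj b a) S X) := by
      refine Finset.card_bij' (fun q _ => q.swap) (fun q _ => q.swap) ?_ ?_ ?_ ?_ <;>
        simp +contextual [crossNonadj, hXX]
    rwa [h1, h2]

lemma exists_rank {M Adj : V → V → Prop} {r : ℕ} (hr : 1 ≤ r)
    (hM : ∀ a b, a ≠ b → ¬ Adj a b → ¬ Adj b a → M a b ∨ M b a)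
    (hfree : ∀ k, 1 ≤ k → k ≤ r + 2 → ∀ x, ¬ HasWalk Adj k x x) (S : Finset V) :
    ∃ f : V → ℕ, r * #(pairsIn (fun a b => Adj a b ∧ ¬ f a < f b) S) ≤ #(pairsIn M S) := by
  induction S using Finset.strongInduction with
  | H S ih =>
    by_cases harc : ∃ a b, Adj a b ∧ a ∈ S ∧ b ∈ S
    swap
    · refine ⟨fun _ => 0, ?_⟩
      have : pairsIn (fun a b => Adj a b ∧ ¬ (fun _ : V => 0) a < (fun _ : V => 0) b) S = ∅ := by
        ext ⟨a, b⟩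
        simp only [pairsIn, mem_filter, mem_product, notMem_empty, iff_false]
        exact fun h => harc ⟨a, b, h.2.1, h.1⟩
      rw [this]
      simp
    obtain ⟨X, hXS, hX, hcut⟩ := exists_cut (Adj := fun a b => Adj a b ∧ a ∈ S ∧ b ∈ S) hr
      (fun a b h => h.2) (fun k h1 h2 x h => hfree k h1 h2 x (h.mono fun _ _ h => h.1)) harc
    have hnon : crossNonadj (fun a b => Adj a b ∧ a ∈ S ∧ b ∈ S) S X = crossNonadj Adj S X := by
      ext ⟨a, b⟩
      have hXS' : a ∈ X → a ∈ S := fun h => hXS.subset h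
      simp only [crossNonadj, mem_filter, mem_product, mem_sdiff]
      tauto
    have hleave : leavingArcs (fun a b => Adj a b ∧ a ∈ S ∧ b ∈ S) S X = leavingArcs Adj S X := by
      ext ⟨a, b⟩
      have hXS' : a ∈ X → a ∈ S := fun h => hXS.subset h
      simp only [leavingArcs, mem_filter, mem_product, mem_sdiff]
      tauto
    rw [hnon, hleave] at hcut
    obtain ⟨f, hf⟩ := ih X hXS
    obtain ⟨g, hg⟩ := ih (S \ X) (Finset.sdiff_ssubset hXS.subset hX)
    refine ⟨fun x => if x ∈ X then f x + S.sup g + 1 else g x, ?_⟩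
    beta_reduce
    have hsub : pairsIn (fun a b => Adj a b ∧ ¬ (if a ∈ X then f a + S.sup g + 1 else g a) <
        (if b ∈ X then f b + S.sup g + 1 else g b)) S ⊆
        (pairsIn (fun a b => Adj a b ∧ ¬ f a < f b) X ∪
          pairsIn (fun a b => Adj a b ∧ ¬ g a < g b) (S \ X)) ∪ leavingArcs Adj S X := by
      rintro ⟨a, b⟩ h
      simp only [pairsIn, leavingArcs, mem_union, mem_filter, mem_product, mem_sdiff] at h ⊢
      obtain ⟨⟨ha, hb⟩, hab, h⟩ := h
      have hga : g a ≤ S.sup g := Finset.le_sup ha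
      by_cases haX : a ∈ X <;> by_cases hbX : b ∈ X <;>
        simp only [haX, hbX, ha, hb, hab, if_true, if_false, true_and, and_true, not_true,
          not_false_eq_true, false_and, and_false, or_false, false_or] at h ⊢ <;> omega
    have hcard := (Finset.card_le_card hsub).trans ((Finset.card_union_le _ _).trans
      (Nat.add_le_add_right (Finset.card_union_le _ _) _))
    have htot := card_pairsIn_add_le hXS.subset hM
    have := Nat.mul_le_mul_left r hcard
    rw [Nat.mul_add, Nat.mul_add] at this
    omega

end Cut

lemma acyclic_of_rank {V : Type*} {Adj : V → V → Prop} (f : V → ℕ)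
    (hf : ∀ a b, Adj a b → f a < f b) : Acyclic Adj := by
  rintro k hk ⟨c, -, hc⟩
  have : Nonempty (Fin k) := ⟨⟨0, hk⟩⟩
  obtain ⟨i, hi⟩ := Finite.exists_max (fun i => f (c i))
  exact absurd (hf _ _ (hc i)) (not_lt.2 (hi _))

theorem liang_xu {V : Type*} [Fintype V]
    (m : ℕ) (hm : 3 ≤ m)
    (T Adj : V → V → Prop) (hT : IsTournament T)
    (hsub : ∀ a b, Adj a b → T a b)
    (t : ℕ) (hcount : deletedCount T Adj = t)
    (hfree : MFree Adj m) :
    ∃ Adj' : V → V → Prop, (∀ a b, Adj' a b → Adj a b) ∧ Acyclic Adj' ∧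
      (deletedCount Adj Adj' : ℝ) ≤ (t : ℝ) / ((m : ℝ) - 2) := by
  classical
  obtain ⟨r, rfl⟩ : ∃ r, m = r + 2 := ⟨m - 2, by omega⟩
  have hM : ∀ a b, a ≠ b → ¬ Adj a b → ¬ Adj b a →
      (T a b ∧ ¬ Adj a b) ∨ (T b a ∧ ¬ Adj b a) := by
    intro a b hab h1 h2
    have := hT.2 a b hab
    tauto
  obtain ⟨f, hf⟩ := exists_rank (M := fun a b => T a b ∧ ¬ Adj a b) (r := r) (by omega) hM
    hfree.not_hasWalk Finset.univ
  refine ⟨fun a b => Adj a b ∧ f a < f b, fun a b h => h.1,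
    acyclic_of_rank f fun a b h => h.2, ?_⟩
  have h1 : deletedCount T Adj = #(pairsIn (fun a b => T a b ∧ ¬ Adj a b) univ) := by
    rw [deletedCount, ← Set.ncard_coe_finset]
    simp [pairsIn]
  have h2 : deletedCount Adj (fun a b => Adj a b ∧ f a < f b) =
      #(pairsIn (fun a b => Adj a b ∧ ¬ f a < f b) univ) := by
    rw [deletedCount, ← Set.ncard_coe_finset]
    congr 1
    ext p
    simp [pairsIn]
    tauto
  have hr : (0 : ℝ) < r := by
    exact_mod_cast (by omega : 0 < r)
  rw [← h2, ← h1, hcount] at hf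
  rw [show ((r + 2 : ℕ) : ℝ) - 2 = r by push_cast; ring, le_div_iff₀ hr, mul_comm]
  exact_mod_cast hf
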